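/- There exists an F-linear operator G on F[z_1,…,z_N] such that for every polynomial f ∈ F[z_1,…,z_N] symmetric in all N variables: [ Σ_{i=1}^N D_i² , B⁺_{N−1} ] f = B⁺_{N−1} ( 2 Σ_{i=1}^N D_i + (N−1)(1+β) ) f + G ( Ñ_N f ). -/

import Mathlib

open MvPolynomial Finset

section CSDefs

variable {F : Type*} [Field F] [CharZero F]

/-- Exact division in a polynomial ring: `divExact d f = f / d` when `d ∣ f`, junk otherwise. -/
noncomputable def divExact {σ : Type*} (d f : MvPolynomial σ F) : MvPolynomial σ F := by
  classical exact if h : ∃ c, f = d * c then h.choose else 0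

/-- The exchange operator `K_{ij}` permuting the variables `z_i` and `z_j`. -/
noncomputable def Kswap {N : ℕ} (i j : Fin N) (f : MvPolynomial (Fin N) F) :
    MvPolynomial (Fin N) F :=
  rename (Equiv.swap i j) f

/-- The Dunkl operator `∇_i = ∂_i + β ∑_{j ≠ i} (z_i - z_j)⁻¹ (1 - K_{ij})`. -/
noncomputable def nabla {N : ℕ} (β : F) (i : Fin N) (f : MvPolynomial (Fin N) F) :
    MvPolynomial (Fin N) F :=
  pderiv i f + β • ∑ j ∈ Finset.univ.erase i, divExact (X i - X j) (f - Kswap i j f)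

/-- `D_i = z_i ∇_i`. -/
noncomputable def Dop {N : ℕ} (β : F) (i : Fin N) (f : MvPolynomial (Fin N) F) :
    MvPolynomial (Fin N) F :=
  X i * nabla β i f

/-- `(D_{j₁} + kβ)(D_{j₂} + (k+1)β) ⋯` applied along a list of indices. -/
noncomputable def Dlist {N : ℕ} (β : F) :
    ℕ → List (Fin N) → MvPolynomial (Fin N) F → MvPolynomial (Fin N) F
  | _, [], f => f
  | k, j :: rest, f => Dop β j (Dlist β (k + 1) rest f) + ((k : F) * β) • Dlist β (k + 1) rest f

/-- `D_{k,J} = (D_{j₁} + kβ)(D_{j₂} + (k+1)β) ⋯ (D_{j_ℓ} + (k+ℓ-1)β)` for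
`J = {j₁ < j₂ < … < j_ℓ}`. -/
noncomputable def DJ {N : ℕ} (β : F) (k : ℕ) (J : Finset (Fin N))
    (f : MvPolynomial (Fin N) F) : MvPolynomial (Fin N) F :=
  Dlist β k (J.sort (· ≤ ·)) f

/-- `z_J = ∏_{i ∈ J} z_i`. -/
noncomputable def zJ {N : ℕ} (J : Finset (Fin N)) : MvPolynomial (Fin N) F := ∏ i ∈ J, X i

/-- The creation operator `B⁺_{i,J} = ∑_{J' ⊆ J, |J'| = i} z_{J'} D_{1,J'}`. -/
noncomputable def Bplus {N : ℕ} (β : F) (i : ℕ) (J : Finset (Fin N))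
    (f : MvPolynomial (Fin N) F) : MvPolynomial (Fin N) F :=
  ∑ J' ∈ J.powersetCard i, zJ J' * DJ β 1 J' f

/-- `A_{ij} = ((z_i+z_j)/(z_i-z_j))(z_i ∂_i - z_j ∂_j)`. -/
noncomputable def Aop {N : ℕ} (i j : Fin N) (f : MvPolynomial (Fin N) F) :
    MvPolynomial (Fin N) F :=
  divExact (X i - X j) ((X i + X j) * (X i * pderiv i f - X j * pderiv j f))

/-- `H^{(S)} = ∑_{i ∈ S} (z_i ∂_i)² + β ∑_{i<j, i,j ∈ S} A_{ij}`. -/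
noncomputable def Hop {N : ℕ} (β : F) (S : Finset (Fin N)) (f : MvPolynomial (Fin N) F) :
    MvPolynomial (Fin N) F :=
  ∑ i ∈ S, X i * pderiv i (X i * pderiv i f)
    + β • ∑ i ∈ S, ∑ j ∈ S.filter (fun j => i < j), Aop i j f

/-- A polynomial is symmetric in the variables indexed by `S`. -/
def SymmOn {N : ℕ} (S : Finset (Fin N)) (f : MvPolynomial (Fin N) F) : Prop :=
  ∀ i ∈ S, ∀ j ∈ S, rename (Equiv.swap i j) f = f

/-- `phiCS β N lam i = (B⁺_i)^{λ_i - λ_{i+1}} ⋯ (B⁺_1)^{λ_1 - λ_2} · 1`,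
where `lam` is 0-indexed: `lam (j-1) = λ_j`. -/
noncomputable def phiCS (β : F) (N : ℕ) (lam : ℕ → ℕ) : ℕ → MvPolynomial (Fin N) F
  | 0 => 1
  | i + 1 => (fun f => Bplus β (i + 1) Finset.univ f)^[lam i - lam (i + 1)] (phiCS β N lam i)

/-- The monomial symmetric polynomial attached to an exponent vector. -/
noncomputable def msym (N : ℕ) (lam : Fin N → ℕ) : MvPolynomial (Fin N) F := by
  classical
  exact ∑ v ∈ (Finset.univ : Finset (Equiv.Perm (Fin N))).image
      (fun σ => fun i => lam (σ i)), ∏ i, X i ^ v i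

/-- `𝐷̂_i = D_i + β(i-1) - β ∑_{j<i} (1 - K_{ij})` (0-indexed: `i-1` becomes `i`). -/
noncomputable def Dhat {N : ℕ} (β : F) (i : Fin N) (f : MvPolynomial (Fin N) F) :
    MvPolynomial (Fin N) F :=
  Dop β i f + (β * ((i : ℕ) : F)) • f
    - β • ∑ j ∈ Finset.univ.filter (fun j => j < i), (f - Kswap i j f)

end CSDefs

section Dunkl

variable {F : Type*} [Field F] {N : ℕ}

theorem X_sub_X_dvd_sub_rename_swap (i j : Fin N) (f : MvPolynomial (Fin N) F) :
    (X i - X j : MvPolynomial (Fin N) F) ∣ f - rename (Equiv.swap i j) f := by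
  rw [← Ideal.mem_span_singleton, ← Ideal.Quotient.eq]
  set I := Ideal.span {(X i - X j : MvPolynomial (Fin N) F)} with hI
  have hij : Ideal.Quotient.mk I (X i) = Ideal.Quotient.mk I (X j) := by
    rw [Ideal.Quotient.eq, hI, Ideal.mem_span_singleton]
  have h : Ideal.Quotient.mkₐ F I = (Ideal.Quotient.mkₐ F I).comp (rename (Equiv.swap i j)) := by
    refine MvPolynomial.algHom_ext fun k => ?_
    simp only [AlgHom.comp_apply, rename_X, Ideal.Quotient.mkₐ_eq_mk]
    rcases eq_or_ne k i with rfl | hki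
    · rw [Equiv.swap_apply_left, hij]
    · rcases eq_or_ne k j with rfl | hkj
      · rw [Equiv.swap_apply_right, hij]
      · rw [Equiv.swap_apply_of_ne_of_ne hki hkj]
  exact DFunLike.congr_fun h f

theorem X_sub_X_ne_zero {i j : Fin N} (h : i ≠ j) :
    (X i - X j : MvPolynomial (Fin N) F) ≠ 0 :=
  sub_ne_zero.2 fun e => h (X_injective e)

theorem mul_divExact {σ : Type*} {d f : MvPolynomial σ F} (h : d ∣ f) :
    d * divExact d f = f := by
  have h' : ∃ c, f = d * c := h
  unfold divExact
  rw [dif_pos h']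
  exact h'.choose_spec.symm

/-- The divided difference `(z_i - z_j)⁻¹ (1 - K_{ij})`. -/
noncomputable def divDiff (i j : Fin N) (f : MvPolynomial (Fin N) F) : MvPolynomial (Fin N) F :=
  divExact (X i - X j) (f - Kswap i j f)

theorem X_sub_X_mul_divDiff (i j : Fin N) (f : MvPolynomial (Fin N) F) :
    (X i - X j) * divDiff i j f = f - rename (Equiv.swap i j) f :=
  mul_divExact (X_sub_X_dvd_sub_rename_swap i j f)

theorem divDiff_eq {i j : Fin N} (h : i ≠ j) {f g : MvPolynomial (Fin N) F}
    (hg : (X i - X j) * g = f - rename (Equiv.swap i j) f) : divDiff i j f = g :=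
  mul_left_cancel₀ (X_sub_X_ne_zero h) ((X_sub_X_mul_divDiff i j f).trans hg.symm)

theorem divDiff_mul {i j : Fin N} (h : i ≠ j) (u f : MvPolynomial (Fin N) F) :
    divDiff i j (u * f) = u * divDiff i j f + divDiff i j u * rename (Equiv.swap i j) f := by
  apply divDiff_eq h
  rw [map_mul]
  linear_combination u * X_sub_X_mul_divDiff i j f +
    rename (Equiv.swap i j) f * X_sub_X_mul_divDiff i j u

theorem divDiff_add {i j : Fin N} (h : i ≠ j) (f g : MvPolynomial (Fin N) F) :
    divDiff i j (f + g) = divDiff i j f + divDiff i j g := by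
  apply divDiff_eq h
  rw [map_add]
  linear_combination X_sub_X_mul_divDiff i j f + X_sub_X_mul_divDiff i j g

theorem divDiff_smul {i j : Fin N} (h : i ≠ j) (c : F) (f : MvPolynomial (Fin N) F) :
    divDiff i j (c • f) = c • divDiff i j f := by
  apply divDiff_eq h
  rw [map_smul, mul_smul_comm, X_sub_X_mul_divDiff, smul_sub]

theorem divDiff_of_symm {i j : Fin N} (h : i ≠ j) {u : MvPolynomial (Fin N) F}
    (hu : rename (Equiv.swap i j) u = u) : divDiff i j u = 0 :=
  divDiff_eq h (by rw [hu, mul_zero, sub_self])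

theorem rename_divDiff (σ : Equiv.Perm (Fin N)) {i j : Fin N} (h : i ≠ j)
    (f : MvPolynomial (Fin N) F) :
    rename σ (divDiff i j f) = divDiff (σ i) (σ j) (rename σ f) := by
  symm
  apply divDiff_eq (σ.injective.ne h)
  have := congrArg (rename σ) (X_sub_X_mul_divDiff i j f)
  simp only [map_mul, map_sub, rename_X, rename_rename] at this
  rw [this, rename_rename, ← Equiv.Perm.coe_mul, ← Equiv.Perm.coe_mul, Equiv.swap_apply_apply]
  simp

theorem pderiv_rename_perm (σ : Equiv.Perm (Fin N)) (i : Fin N) (f : MvPolynomial (Fin N) F) :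
    pderiv (σ i) (rename σ f) = rename σ (pderiv i f) :=
  pderiv_rename σ.injective i f

variable (β : F)

/-- The Dunkl operator as a linear map. -/
noncomputable def dunkl (i : Fin N) : MvPolynomial (Fin N) F →ₗ[F] MvPolynomial (Fin N) F where
  toFun := nabla β i
  map_add' f g := by
    change pderiv i _ + β • ∑ j ∈ univ.erase i, divDiff i j _ =
      pderiv i _ + β • ∑ j ∈ univ.erase i, divDiff i j _ +
      (pderiv i _ + β • ∑ j ∈ univ.erase i, divDiff i j _)
    rw [map_add, sum_congr rfl fun j hj => divDiff_add (ne_of_mem_erase hj).symm f g,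
      sum_add_distrib]
    module
  map_smul' c f := by
    change pderiv i _ + β • ∑ j ∈ univ.erase i, divDiff i j _ =
      c • (pderiv i _ + β • ∑ j ∈ univ.erase i, divDiff i j _)
    rw [Derivation.map_smul, sum_congr rfl fun j hj => divDiff_smul (ne_of_mem_erase hj).symm c f,
      ← smul_sum]
    module

theorem dunkl_apply (i : Fin N) (f : MvPolynomial (Fin N) F) :
    dunkl β i f = pderiv i f + β • ∑ j ∈ univ.erase i, divDiff i j f := rfl

theorem dunkl_mul (i : Fin N) (u f : MvPolynomial (Fin N) F) :
    dunkl β i (u * f) = u * dunkl β i f + pderiv i u * f +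
      β • ∑ j ∈ univ.erase i, divDiff i j u * rename (Equiv.swap i j) f := by
  rw [dunkl_apply, dunkl_apply, pderiv_mul,
    sum_congr rfl fun j hj => divDiff_mul (ne_of_mem_erase hj).symm u f, sum_add_distrib,
    ← mul_sum, mul_add, mul_smul_comm]
  module

theorem rename_dunkl (σ : Equiv.Perm (Fin N)) (i : Fin N) (f : MvPolynomial (Fin N) F) :
    rename σ (dunkl β i f) = dunkl β (σ i) (rename σ f) := by
  rw [dunkl_apply, dunkl_apply, pderiv_rename_perm, map_add, map_smul, map_sum]
  congr 2
  refine sum_nbij' σ σ.symm ?_ ?_ ?_ ?_ ?_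
  · simp
  · intro j hj
    simp only [mem_erase, mem_univ, and_true] at hj ⊢
    rintro rfl
    simp at hj
  · simp
  · simp
  · intro j hj
    exact rename_divDiff σ (ne_of_mem_erase hj).symm f

theorem divDiff_X_of_ne {i j k : Fin N} (h : i ≠ j) (hi : k ≠ i) (hj : k ≠ j) :
    divDiff i j (X k : MvPolynomial (Fin N) F) = 0 :=
  divDiff_of_symm h (by rw [rename_X, Equiv.swap_apply_of_ne_of_ne hi hj])

theorem divDiff_X_left {i j : Fin N} (h : i ≠ j) :
    divDiff i j (X i : MvPolynomial (Fin N) F) = 1 :=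
  divDiff_eq h (by rw [rename_X, Equiv.swap_apply_left, mul_one])

theorem divDiff_X_right {i j : Fin N} (h : i ≠ j) :
    divDiff i j (X j : MvPolynomial (Fin N) F) = -1 :=
  divDiff_eq h (by rw [rename_X, Equiv.swap_apply_right]; ring)

theorem dunkl_X_mul_of_ne {i k : Fin N} (h : k ≠ i) (f : MvPolynomial (Fin N) F) :
    dunkl β i (X k * f) = X k * dunkl β i f - β • rename (Equiv.swap i k) f := by
  rw [dunkl_mul, pderiv_X_of_ne h, zero_mul, sum_eq_single k]
  · rw [divDiff_X_right h.symm, neg_one_mul]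
    module
  · intro j hj hjk
    rw [divDiff_X_of_ne (ne_of_mem_erase hj).symm h hjk.symm, zero_mul]
  · simp [h]

theorem dunkl_X_mul_self (i : Fin N) (f : MvPolynomial (Fin N) F) :
    dunkl β i (X i * f) = X i * dunkl β i f + f +
      β • ∑ j ∈ univ.erase i, rename (Equiv.swap i j) f := by
  rw [dunkl_mul, pderiv_X_self, one_mul]
  congr 2
  refine sum_congr rfl fun j hj => ?_
  rw [divDiff_X_left (ne_of_mem_erase hj).symm, one_mul]

theorem dunkl_C (i : Fin N) (c : F) : dunkl β i (C c) = 0 := by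
  rw [dunkl_apply, pderiv_C, sum_eq_zero, smul_zero, add_zero]
  intro j hj
  exact divDiff_of_symm (ne_of_mem_erase hj).symm (rename_C _ _)

theorem dunkl_comm_step {i j : Fin N} (h : i ≠ j) (f : MvPolynomial (Fin N) F)
    (hf : dunkl β i (dunkl β j f) = dunkl β j (dunkl β i f)) :
    dunkl β i (dunkl β j (X i * f)) = dunkl β j (dunkl β i (X i * f)) := by
  rw [dunkl_X_mul_self, dunkl_X_mul_of_ne β h, map_sub, map_smul, map_add, map_add,
    dunkl_X_mul_self, dunkl_X_mul_of_ne β h, map_smul, map_sum,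
    ← add_sum_erase _ _ (mem_erase.2 ⟨h.symm, mem_univ j⟩),
    ← add_sum_erase _ _ (mem_erase.2 ⟨h.symm, mem_univ j⟩), hf,
    sum_congr rfl fun k hk => ?_, Equiv.swap_comm j i, rename_dunkl, rename_dunkl,
    Equiv.swap_apply_left, Equiv.swap_apply_right]
  rotate_left
  · exact fun k => dunkl β j (rename (Equiv.swap i k) f)
  · rw [rename_dunkl, Equiv.swap_apply_of_ne_of_ne h.symm]
    simp only [mem_erase] at hk
    exact hk.1.symm
  module

theorem dunkl_comm (i j : Fin N) (f : MvPolynomial (Fin N) F) :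
    dunkl β i (dunkl β j f) = dunkl β j (dunkl β i f) := by
  rcases eq_or_ne i j with rfl | h
  · rfl
  induction f using MvPolynomial.induction_on with
  | C c => rw [dunkl_C, dunkl_C, map_zero, map_zero]
  | add p q hp hq => rw [map_add, map_add, map_add, map_add, hp, hq]
  | mul_X p k hp =>
    rw [mul_comm]
    rcases eq_or_ne k i with rfl | hki
    · exact dunkl_comm_step β h p hp
    rcases eq_or_ne k j with rfl | hkj
    · exact (dunkl_comm_step β h.symm p hp.symm).symm
    rw [dunkl_X_mul_of_ne β hki, dunkl_X_mul_of_ne β hkj, map_sub, map_sub, map_smul, map_smul,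
      dunkl_X_mul_of_ne β hki, dunkl_X_mul_of_ne β hkj, rename_dunkl, rename_dunkl,
      Equiv.swap_apply_of_ne_of_ne h.symm hkj.symm, Equiv.swap_apply_of_ne_of_ne h hki.symm, hp]
    module

/-- The operator `D_i = z_i ∇_i` as a linear map. -/
noncomputable def dunklD (i : Fin N) : MvPolynomial (Fin N) F →ₗ[F] MvPolynomial (Fin N) F :=
  LinearMap.mulLeft F (X i) ∘ₗ dunkl β i

theorem dunklD_apply (i : Fin N) (f : MvPolynomial (Fin N) F) :
    dunklD β i f = X i * dunkl β i f := rfl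

theorem Dop_eq_dunklD (i : Fin N) (f : MvPolynomial (Fin N) F) : Dop β i f = dunklD β i f := rfl

theorem rename_dunklD (σ : Equiv.Perm (Fin N)) (i : Fin N) (f : MvPolynomial (Fin N) F) :
    rename σ (dunklD β i f) = dunklD β (σ i) (rename σ f) := by
  rw [dunklD_apply, map_mul, rename_X, rename_dunkl, dunklD_apply]

theorem dunklD_comm (i j : Fin N) (f : MvPolynomial (Fin N) F) :
    dunklD β i (dunklD β j f) = dunklD β j (dunklD β i f) +
      β • (dunklD β j (rename (Equiv.swap i j) f) - dunklD β i (rename (Equiv.swap i j) f)) := by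
  rcases eq_or_ne i j with rfl | h
  · simp
  simp only [dunklD_apply]
  rw [dunkl_X_mul_of_ne β h, dunkl_X_mul_of_ne β h.symm, dunkl_comm, Equiv.swap_comm j i,
    rename_dunkl, rename_dunkl, Equiv.swap_apply_left, Equiv.swap_apply_right]
  simp only [mul_sub, smul_sub, mul_smul_comm]
  rw [mul_left_comm]
  abel

end Dunkl

section SwapSums

variable {N : ℕ} {V : Type*} [AddCommGroup V]

theorem sum_sum_swap (i : Fin N) (Ψ : Fin N → Equiv.Perm (Fin N) → V)
    (hΨ : ∀ a σ, σ i = i → Ψ a σ = 0) :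
    ∑ a, ∑ b, Ψ a (Equiv.swap a b) =
      ∑ x, Ψ i (Equiv.swap i x) + ∑ x, Ψ x (Equiv.swap i x) := by
  have key : ∀ a b, Ψ a (Equiv.swap a b) =
      (if a = i then Ψ i (Equiv.swap i b) else 0) +
        (if b = i then Ψ a (Equiv.swap i a) else 0) := by
    intro a b
    by_cases ha : a = i
    · subst ha
      by_cases hb : b = a
      · subst hb
        simpa using hΨ b (Equiv.refl _) rfl
      · simp [hb]
    · by_cases hb : b = i
      · subst hb
        simp [ha, Equiv.swap_comm]
      · simp [ha, hb, hΨ a _ (Equiv.swap_apply_of_ne_of_ne (Ne.symm ha) (Ne.symm hb))]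
  rw [sum_congr rfl fun a _ => sum_congr rfl fun b _ => key a b]
  simp only [sum_add_distrib]
  rw [sum_comm]
  simp

theorem sum_three_cycles (i : Fin N) (h : Fin N → Equiv.Perm (Fin N) → V)
    (hi : ∀ σ, h i σ = 0) :
    ∑ a, ∑ b, ∑ c, (if a ≠ b ∧ b ≠ c ∧ c ≠ a then
      h ((Equiv.swap a b * Equiv.swap b c) i) (Equiv.swap a b * Equiv.swap b c) else 0) =
      3 • (∑ x, ∑ y, h x (Equiv.swap i x * Equiv.swap x y) - ∑ x, h x 1 -
        ∑ x, h x (Equiv.swap i x)) := by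
  set ψ : Fin N → Fin N → V := fun x y =>
    if i ≠ x ∧ x ≠ y ∧ y ≠ i then h x (Equiv.swap i x * Equiv.swap x y) else 0 with hψ
  have rot : ∀ a b c : Fin N, a ≠ b → b ≠ c → c ≠ a →
      Equiv.swap a b * Equiv.swap b c = Equiv.swap b c * Equiv.swap c a := by
    intro a b c hab hbc hca
    rw [Equiv.swap_mul_eq_mul_swap, Equiv.swap_inv, Equiv.swap_apply_left,
      Equiv.swap_apply_of_ne_of_ne hab hca.symm, Equiv.swap_comm a c]
  have key : ∀ a b c, (if a ≠ b ∧ b ≠ c ∧ c ≠ a then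
      h ((Equiv.swap a b * Equiv.swap b c) i) (Equiv.swap a b * Equiv.swap b c) else 0) =
      (if a = i then ψ b c else 0) + (if b = i then ψ c a else 0) +
        (if c = i then ψ a b else 0) := by
    intro a b c
    by_cases hd : a ≠ b ∧ b ≠ c ∧ c ≠ a
    · obtain ⟨hab, hbc, hca⟩ := hd
      by_cases ha : a = i
      · subst ha
        simp [hψ, hab, hbc, hca, hab.symm, Equiv.swap_apply_of_ne_of_ne hab hca.symm]
      by_cases hb : b = i
      · subst hb
        simp [hψ, hab, hbc, hca, hbc.symm, rot a b c hab hbc hca,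
          Equiv.swap_apply_of_ne_of_ne hbc hab.symm]
      by_cases hc : c = i
      · subst hc
        simp [hψ, hab, hbc, hca, hca.symm, rot a b c hab hbc hca, rot b c a hbc hca hab,
          Equiv.swap_apply_of_ne_of_ne hca hbc.symm]
      · simp only [ha, hb, hc, if_false, add_zero]
        rw [Equiv.Perm.mul_apply, Equiv.swap_apply_of_ne_of_ne (Ne.symm hb) (Ne.symm hc),
          Equiv.swap_apply_of_ne_of_ne (Ne.symm ha) (Ne.symm hb), hi, ite_self]
    · rw [if_neg hd]
      have : ∀ x y, (¬ (i ≠ x ∧ x ≠ y ∧ y ≠ i)) → ψ x y = 0 := fun x y hxy => if_neg hxy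
      split_ifs with h1 h2 h3 h3 h2 h3 h3
      all_goals (try subst h1); (try subst h2); (try subst h3)
      all_goals (repeat rw [this _ _ (by tauto)]); try simp
  have hψ' : ∀ x y, ψ x y = h x (Equiv.swap i x * Equiv.swap x y) -
      (if y = i then h x 1 else 0) - (if y = x then h x (Equiv.swap i x) else 0) := by
    intro x y
    simp only [hψ]
    by_cases hx : x = i
    · subst hx
      simp [hi]
    by_cases hy : y = i
    · subst hy
      simp [Ne.symm hx, Equiv.swap_comm]
    by_cases hxy : y = x
    · subst hxy
      simp [hy, ← Equiv.Perm.one_def]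
    · simp [hy, Ne.symm hx, hxy, Ne.symm hxy]
  have hsum : ∑ x, ∑ y, ψ x y = ∑ x, ∑ y, h x (Equiv.swap i x * Equiv.swap x y) - ∑ x, h x 1 -
        ∑ x, h x (Equiv.swap i x) := by
    simp only [hψ', sum_sub_distrib]
    simp
  rw [← hsum]
  simp only [key, sum_add_distrib]
  have e1 : ∑ a, ∑ b, ∑ c, (if a = i then ψ b c else 0) = ∑ x, ∑ y, ψ x y := by
    rw [sum_eq_single i] <;> simp +contextual
  have e2 : ∑ a, ∑ b, ∑ c, (if b = i then ψ c a else 0) = ∑ x, ∑ y, ψ x y := by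
    rw [sum_comm, sum_comm (f := ψ), sum_eq_single i] <;> simp +contextual
  have e3 : ∑ a, ∑ b, ∑ c, (if c = i then ψ a b else 0) = ∑ x, ∑ y, ψ x y := by
    simp
  rw [e1, e2, e3]
  abel

end SwapSums

section Central

variable {F : Type*} [Field F] {N : ℕ} (β : F)

theorem rename_perm_mul (σ τ : Equiv.Perm (Fin N)) (f : MvPolynomial (Fin N) F) :
    rename σ (rename τ f) = rename (σ * τ : Equiv.Perm (Fin N)) f :=
  rename_rename τ σ f

/-- The sum `∑ D_a + (β/2) ∑_{a,b} K_{ab}`, commuting with every `D_i`. -/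
noncomputable def centralOne : MvPolynomial (Fin N) F →ₗ[F] MvPolynomial (Fin N) F :=
  ∑ a, dunklD β a + (β / 2) • ∑ a, ∑ b, (rename (Equiv.swap a b)).toLinearMap

theorem centralOne_apply (f : MvPolynomial (Fin N) F) :
    centralOne β f = ∑ a, dunklD β a f + (β / 2) • ∑ a, ∑ b, rename (Equiv.swap a b) f := by
  simp [centralOne]

theorem sum_dunklD_dunklD (i : Fin N) (f : MvPolynomial (Fin N) F) :
    ∑ a, dunklD β a (dunklD β i f) = ∑ a, dunklD β i (dunklD β a f) -
      β • ∑ a, (dunklD β a (rename (Equiv.swap i a) f) -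
        dunklD β i (rename (Equiv.swap i a) f)) := by
  rw [smul_sum, ← sum_sub_distrib]
  refine sum_congr rfl fun a _ => ?_
  rw [dunklD_comm, Equiv.swap_comm a i]
  module

theorem sum_swap_dunklD (i : Fin N) (f : MvPolynomial (Fin N) F) :
    ∑ a, ∑ b, rename (Equiv.swap a b) (dunklD β i f) =
      ∑ a, ∑ b, dunklD β i (rename (Equiv.swap a b) f) +
      (2 : F) • ∑ a, (dunklD β a (rename (Equiv.swap i a) f) -
        dunklD β i (rename (Equiv.swap i a) f)) := by
  have h := sum_sum_swap i (fun _ σ => dunklD β (σ i) (rename σ f) - dunklD β i (rename σ f))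
    fun a σ hσ => by rw [hσ, sub_self]
  simp only [sum_sub_distrib, Equiv.swap_apply_left] at h
  simp only [rename_dunklD, sum_sub_distrib]
  rw [two_smul]
  linear_combination h

theorem centralOne_dunklD [CharZero F] (i : Fin N) (f : MvPolynomial (Fin N) F) :
    centralOne β (dunklD β i f) = dunklD β i (centralOne β f) := by
  rw [centralOne_apply, centralOne_apply, sum_dunklD_dunklD, sum_swap_dunklD]
  simp only [map_add, map_smul, map_sum]
  module

/-- The sum of the operators permuting the variables by the three-cycles, each three-cycle being
counted three times. -/
noncomputable def threeCycleSum : MvPolynomial (Fin N) F →ₗ[F] MvPolynomial (Fin N) F :=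
  ∑ a, ∑ b, ∑ c, if a ≠ b ∧ b ≠ c ∧ c ≠ a then
    (rename (Equiv.swap a b * Equiv.swap b c : Equiv.Perm (Fin N))).toLinearMap else 0

theorem threeCycleSum_apply (f : MvPolynomial (Fin N) F) :
    threeCycleSum f = ∑ a, ∑ b, ∑ c, if a ≠ b ∧ b ≠ c ∧ c ≠ a then
      rename (Equiv.swap a b * Equiv.swap b c : Equiv.Perm (Fin N)) f else 0 := by
  simp only [threeCycleSum, LinearMap.sum_apply]
  refine sum_congr rfl fun a _ => sum_congr rfl fun b _ => sum_congr rfl fun c _ => ?_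
  split_ifs <;> rfl

theorem threeCycleSum_dunklD (i : Fin N) (f : MvPolynomial (Fin N) F) :
    threeCycleSum (dunklD β i f) = dunklD β i (threeCycleSum f) +
      (3 : F) • (∑ x, ∑ y, (dunklD β x (rename (Equiv.swap i x) (rename (Equiv.swap x y) f)) -
          dunklD β i (rename (Equiv.swap i x) (rename (Equiv.swap x y) f))) -
        ∑ x, (dunklD β x f - dunklD β i f) -
        ∑ x, (dunklD β x (rename (Equiv.swap i x) f) -
          dunklD β i (rename (Equiv.swap i x) f))) := by
  have h := sum_three_cycles i (fun x σ => dunklD β x (rename σ f) - dunklD β i (rename σ f))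
    fun σ => sub_self _
  have h1 : rename (1 : Equiv.Perm (Fin N)) f = f := rename_id_apply f
  simp only [h1, ← rename_perm_mul] at h
  rw [← sub_eq_iff_eq_add', ofNat_smul_eq_nsmul, ← h, threeCycleSum_apply, threeCycleSum_apply]
  simp only [map_sum, ← sum_sub_distrib]
  refine sum_congr rfl fun a _ => sum_congr rfl fun b _ => sum_congr rfl fun c _ => ?_
  split_ifs
  · rw [rename_dunklD, rename_perm_mul]
  · rw [map_zero, sub_zero]

theorem sum_dunklD_sq_dunklD (i : Fin N) (f : MvPolynomial (Fin N) F) :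
    ∑ a, dunklD β a (dunklD β a (dunklD β i f)) =
      ∑ a, dunklD β i (dunklD β a (dunklD β a f)) -
      β • ∑ a, (dunklD β a (dunklD β a (rename (Equiv.swap i a) f)) -
        dunklD β i (dunklD β i (rename (Equiv.swap i a) f))) := by
  rw [smul_sum, ← sum_sub_distrib]
  refine sum_congr rfl fun a _ => ?_
  rw [dunklD_comm β a i f, map_add, map_smul, map_sub, dunklD_comm β a i (dunklD β a f),
    rename_dunklD, Equiv.swap_apply_left, Equiv.swap_comm a i]
  module

theorem sum_dunklD_swap_dunklD (i : Fin N) (f : MvPolynomial (Fin N) F) :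
    ∑ a, ∑ b, dunklD β a (rename (Equiv.swap a b) (dunklD β i f)) =
      ∑ a, ∑ b, dunklD β i (dunklD β a (rename (Equiv.swap a b) f)) +
      ∑ a, (dunklD β a (dunklD β a (rename (Equiv.swap i a) f)) -
        dunklD β i (dunklD β i (rename (Equiv.swap i a) f))) +
      β • (∑ a, (dunklD β a f - dunklD β i f) -
        ∑ a, ∑ b, (dunklD β a (rename (Equiv.swap i a) (rename (Equiv.swap a b) f)) -
          dunklD β i (rename (Equiv.swap i a) (rename (Equiv.swap a b) f)))) := by
  have h := sum_sum_swap i (fun a σ => dunklD β a (dunklD β (σ i) (rename σ f)) -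
    dunklD β a (dunklD β i (rename σ f))) fun a σ hσ => by rw [hσ, sub_self]
  simp only [Equiv.swap_apply_left] at h
  have h2 : ∀ a, dunklD β i (dunklD β a (rename (Equiv.swap i a) f)) =
      dunklD β a (dunklD β i (rename (Equiv.swap i a) f)) +
        β • (dunklD β a f - dunklD β i f) := by
    intro a
    rw [dunklD_comm β i a, rename_perm_mul, Equiv.swap_mul_self]
    rw [show rename (1 : Equiv.Perm (Fin N)) f = f from rename_id_apply f]
  have h3 : ∀ a b, dunklD β a (rename (Equiv.swap a b) (dunklD β i f)) =
      dunklD β i (dunklD β a (rename (Equiv.swap a b) f)) +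
      (dunklD β a (dunklD β (Equiv.swap a b i) (rename (Equiv.swap a b) f)) -
        dunklD β a (dunklD β i (rename (Equiv.swap a b) f))) -
      β • (dunklD β a (rename (Equiv.swap i a) (rename (Equiv.swap a b) f)) -
          dunklD β i (rename (Equiv.swap i a) (rename (Equiv.swap a b) f))) := by
    intro a b
    rw [rename_dunklD, dunklD_comm β a i, Equiv.swap_comm a i]
    module
  simp only [h3, sum_sub_distrib, sum_add_distrib, smul_sub, ← smul_sum] at h ⊢
  have h2' := sum_congr (rfl : (univ : Finset (Fin N)) = univ) fun a _ => h2 a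
  simp only [sum_sub_distrib, sum_add_distrib, smul_sub, ← smul_sum] at h2'
  linear_combination h + h2'

/-- A quadratic combination of the `D_a` and the permutations commuting with every `D_i`. -/
noncomputable def centralTwo : MvPolynomial (Fin N) F →ₗ[F] MvPolynomial (Fin N) F :=
  ∑ a, dunklD β a ∘ₗ dunklD β a +
    β • (∑ a, ∑ b, dunklD β a ∘ₗ (rename (Equiv.swap a b)).toLinearMap -
      (N : F) • ∑ a, dunklD β a) +
    (β ^ 2 / 3) • threeCycleSum -
    (β ^ 2 * (N - 1) / 2) • ∑ a, ∑ b, (rename (Equiv.swap a b)).toLinearMap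

theorem centralTwo_apply (f : MvPolynomial (Fin N) F) :
    centralTwo β f = ∑ a, dunklD β a (dunklD β a f) +
      β • (∑ a, ∑ b, dunklD β a (rename (Equiv.swap a b) f) - (N : F) • ∑ a, dunklD β a f) +
      (β ^ 2 / 3) • threeCycleSum f -
      (β ^ 2 * (N - 1) / 2) • ∑ a, ∑ b, rename (Equiv.swap a b) f := by
  simp [centralTwo]

theorem centralTwo_dunklD [CharZero F] (i : Fin N) (f : MvPolynomial (Fin N) F) :
    centralTwo β (dunklD β i f) = dunklD β i (centralTwo β f) := by
  rw [centralTwo_apply, centralTwo_apply, sum_dunklD_dunklD, sum_swap_dunklD,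
    threeCycleSum_dunklD, sum_dunklD_sq_dunklD, sum_dunklD_swap_dunklD]
  simp only [map_add, map_smul, map_sum, map_sub]
  module

end Central

section DunklList

variable {F : Type*} [Field F] {N : ℕ} (β : F)

/-- The operator `(D_{j₁} + kβ)(D_{j₂} + (k+1)β) ⋯` as a linear map. -/
noncomputable def dunklList :
    ℕ → List (Fin N) → MvPolynomial (Fin N) F →ₗ[F] MvPolynomial (Fin N) F
  | _, [] => LinearMap.id
  | k, j :: L => (dunklD β j + ((k : F) * β) • LinearMap.id) ∘ₗ dunklList (k + 1) L

theorem dunklList_cons (k : ℕ) (j : Fin N) (L : List (Fin N)) (f : MvPolynomial (Fin N) F) :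
    dunklList β k (j :: L) f =
      dunklD β j (dunklList β (k + 1) L f) + ((k : F) * β) • dunklList β (k + 1) L f := rfl

theorem Dlist_eq_dunklList (k : ℕ) (L : List (Fin N)) (f : MvPolynomial (Fin N) F) :
    Dlist β k L f = dunklList β k L f := by
  induction L generalizing k with
  | nil => rfl
  | cons j L ih => rw [Dlist, dunklList_cons, ih, Dop_eq_dunklD]

theorem dunklList_comm (T : MvPolynomial (Fin N) F →ₗ[F] MvPolynomial (Fin N) F)
    (hT : ∀ i f, T (dunklD β i f) = dunklD β i (T f)) (k : ℕ) (L : List (Fin N))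
    (f : MvPolynomial (Fin N) F) : T (dunklList β k L f) = dunklList β k L (T f) := by
  induction L generalizing k with
  | nil => rfl
  | cons j L ih => rw [dunklList_cons, dunklList_cons, map_add, map_smul, hT, ih]

theorem rename_dunklList (σ : Equiv.Perm (Fin N)) (k : ℕ) (L : List (Fin N))
    (f : MvPolynomial (Fin N) F) :
    rename σ (dunklList β k L f) = dunklList β k (L.map σ) (rename σ f) := by
  induction L generalizing k with
  | nil => rfl
  | cons j L ih =>
    rw [dunklList_cons, List.map_cons, dunklList_cons, map_add, map_smul, rename_dunklD, ih]

theorem dunklList_perm {f : MvPolynomial (Fin N) F} (hf : f.IsSymmetric) {L L' : List (Fin N)}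
    (h : L.Perm L') (hL : L.Nodup) (k : ℕ) : dunklList β k L f = dunklList β k L' f := by
  induction h generalizing k with
  | nil => rfl
  | cons a _ ih => rw [dunklList_cons, dunklList_cons, ih hL.of_cons]
  | swap a b L =>
    simp only [List.nodup_cons, List.mem_cons, not_or] at hL
    have hK : rename (Equiv.swap b a) (dunklList β (k + 1 + 1) L f) =
        dunklList β (k + 1 + 1) L f := by
      have hm : L.map (Equiv.swap b a) = L.map id := List.map_congr_left fun c hc =>
        Equiv.swap_apply_of_ne_of_ne (ne_of_mem_of_not_mem hc hL.1.2)
          (ne_of_mem_of_not_mem hc hL.2.1)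
      rw [rename_dunklList, hf, hm, List.map_id]
    simp only [dunklList_cons, map_add, map_smul, dunklD_comm β b a, hK]
    push_cast
    module
  | trans h₁ _ ih₁ ih₂ => rw [ih₁ hL, ih₂ (h₁.nodup_iff.1 hL)]

/-- The polynomial `D_{1,J} f` for `J` the complement of `{i}`. -/
noncomputable def coDunkl (f : MvPolynomial (Fin N) F) (i : Fin N) : MvPolynomial (Fin N) F :=
  dunklList β 1 ((univ.erase i).sort (· ≤ ·)) f

theorem rename_coDunkl {f : MvPolynomial (Fin N) F} (hf : f.IsSymmetric)
    (σ : Equiv.Perm (Fin N)) (i : Fin N) :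
    rename σ (coDunkl β f i) = coDunkl β f (σ i) := by
  rw [coDunkl, rename_dunklList, hf, coDunkl]
  refine dunklList_perm β hf ?_ ((sort_nodup _ _).map σ.injective) 1
  rw [List.perm_ext_iff_of_nodup ((sort_nodup _ _).map σ.injective) (sort_nodup _ _)]
  intro a
  simp only [List.mem_map, mem_sort, mem_erase, mem_univ, and_true]
  constructor
  · rintro ⟨b, hb, rfl⟩
    exact σ.injective.ne hb
  · intro ha
    exact ⟨σ.symm a, fun h => ha (by rw [← h, Equiv.apply_symm_apply]), by simp⟩

theorem dunklD_coDunkl {f : MvPolynomial (Fin N) F} (hf : f.IsSymmetric) (i : Fin N) :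
    dunklD β i (coDunkl β f i) = DJ β 0 univ f := by
  have h := dunklList_cons β 0 i ((univ.erase i).sort (· ≤ ·)) f
  rw [Nat.cast_zero, zero_mul, zero_smul, add_zero] at h
  rw [DJ, Dlist_eq_dunklList]
  refine h.symm.trans ?_
  have hn : (i :: (univ.erase i).sort (· ≤ ·)).Nodup :=
    List.nodup_cons.2 ⟨by simp, sort_nodup _ _⟩
  refine dunklList_perm β hf ?_ hn 0
  rw [List.perm_ext_iff_of_nodup hn (sort_nodup _ _)]
  intro a
  simp [em]

theorem dunklList_sum_dunklD [CharZero F] {f : MvPolynomial (Fin N) F} (hf : f.IsSymmetric)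
    (i : Fin N) :
    dunklList β 1 ((univ.erase i).sort (· ≤ ·)) (∑ a, dunklD β a f) =
      ∑ a, dunklD β a (coDunkl β f i) + β • ∑ x, (coDunkl β f x - coDunkl β f i) := by
  have h := dunklList_comm β (centralOne β) (centralOne_dunklD β) 1
    ((univ.erase i).sort (· ≤ ·)) f
  rw [centralOne_apply, centralOne_apply, map_add, map_smul] at h
  have hs := sum_sum_swap i (fun _ σ => coDunkl β f (σ i) - coDunkl β f i)
    fun _ σ hσ => by rw [hσ, sub_self]
  simp only [hf _, map_sum, ← coDunkl.eq_1, rename_coDunkl β hf, Equiv.swap_apply_left,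
    sum_sub_distrib] at h hs ⊢
  rw [sub_eq_iff_eq_add] at hs
  rw [hs] at h
  rw [← sub_eq_iff_eq_add] at h
  rw [← h]
  module

theorem dunklList_sum_dunklD_sq [CharZero F] {f : MvPolynomial (Fin N) F} (hf : f.IsSymmetric)
    (i : Fin N) :
    dunklList β 1 ((univ.erase i).sort (· ≤ ·)) (∑ a, dunklD β a (dunklD β a f)) =
      ∑ a, dunklD β a (dunklD β a (coDunkl β f i)) +
        β • ∑ x, (dunklD β i (coDunkl β f x) - dunklD β x (coDunkl β f i)) -
        β ^ 2 • ∑ x, (coDunkl β f x - coDunkl β f i) := by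
  have h := dunklList_comm β (centralTwo β) (centralTwo_dunklD β) 1
    ((univ.erase i).sort (· ≤ ·)) f
  rw [centralTwo_apply, centralTwo_apply] at h
  have hs := sum_sum_swap i (fun _ σ => coDunkl β f (σ i) - coDunkl β f i)
    fun _ σ hσ => by rw [hσ, sub_self]
  have hd := sum_sum_swap i
    (fun a σ => dunklD β a (coDunkl β f (σ i)) - dunklD β a (coDunkl β f i))
    fun _ σ hσ => by rw [hσ, sub_self]
  have ht := sum_three_cycles i (fun x _ => coDunkl β f x - coDunkl β f i) fun _ => sub_self _
  have ht' : threeCycleSum (coDunkl β f i) -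
      dunklList β 1 ((univ.erase i).sort (· ≤ ·)) (threeCycleSum f) =
      (3 * ((N : F) - 2)) • ∑ x, (coDunkl β f x - coDunkl β f i) := by
    have e : (3 * ((N : F) - 2)) • ∑ x, (coDunkl β f x - coDunkl β f i) =
        3 • (∑ x, ∑ y : Fin N, (coDunkl β f x - coDunkl β f i) -
          ∑ x, (coDunkl β f x - coDunkl β f i) - ∑ x, (coDunkl β f x - coDunkl β f i)) := by
      simp only [sum_const, card_univ, Fintype.card_fin, ← Nat.cast_smul_eq_nsmul F, ← smul_sum]
      module
    rw [e, ← ht, threeCycleSum_apply, threeCycleSum_apply]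
    simp only [map_sum, ← sum_sub_distrib]
    refine sum_congr rfl fun a _ => sum_congr rfl fun b _ => sum_congr rfl fun c _ => ?_
    split_ifs
    · rw [rename_coDunkl β hf, hf, coDunkl.eq_1 β f i]
    · rw [map_zero, sub_zero]
  rw [sub_eq_iff_eq_add] at ht'
  have hc : dunklList β 1 ((univ.erase i).sort (· ≤ ·)) f = coDunkl β f i := rfl
  rw [map_sub, map_add, map_add, map_smul, map_smul, map_smul, hc, ht'] at h
  simp only [hf _, map_sum, map_sub, map_smul, sum_const, card_univ, Fintype.card_fin, hc,
    rename_coDunkl β hf, Equiv.swap_apply_left, dunklD_coDunkl β hf,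
    sum_sub_distrib, ← Nat.cast_smul_eq_nsmul F, ← smul_sum] at h hs hd ⊢
  linear_combination (norm := module) -h + β • hd - (β ^ 2 * (N - 1) / 2) • hs

end DunklList

section CoMonomial

variable {F : Type*} [Field F] {N : ℕ} (β : F)

/-- The product of all variables but `z_i`. -/
noncomputable def coX (i : Fin N) : MvPolynomial (Fin N) F := zJ (univ.erase i)

theorem rename_coX (σ : Equiv.Perm (Fin N)) (i : Fin N) :
    rename σ (coX i : MvPolynomial (Fin N) F) = coX (σ i) := by
  simp only [coX, zJ, map_prod, rename_X]
  refine prod_nbij' σ σ.symm ?_ ?_ ?_ ?_ ?_ <;> simp [Equiv.symm_apply_eq]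

theorem X_mul_prod_erase_erase {i j : Fin N} (h : j ≠ i) :
    X j * ∏ k ∈ (univ.erase i).erase j, (X k : MvPolynomial (Fin N) F) = coX i :=
  mul_prod_erase _ _ (mem_erase.2 ⟨h, mem_univ j⟩)

theorem pderiv_prod_X_of_notMem {i : Fin N} {S : Finset (Fin N)} (h : i ∉ S) :
    pderiv i (∏ k ∈ S, X k : MvPolynomial (Fin N) F) = 0 :=
  prod_induction _ (fun p => pderiv i p = 0)
    (fun p q hp hq => by rw [pderiv_mul, hp, hq, zero_mul, mul_zero, add_zero])
    (Derivation.map_one_eq_zero _) fun _ hk => pderiv_X_of_ne (ne_of_mem_of_not_mem hk h)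

theorem pderiv_coX_of_ne {i j : Fin N} (h : j ≠ i) :
    pderiv j (coX i : MvPolynomial (Fin N) F) =
      ∏ k ∈ (univ.erase i).erase j, (X k : MvPolynomial (Fin N) F) := by
  rw [← X_mul_prod_erase_erase h, pderiv_mul, pderiv_X_self, one_mul,
    pderiv_prod_X_of_notMem (notMem_erase _ _), mul_zero, add_zero]

theorem divDiff_coX_right {i j : Fin N} (h : j ≠ i) :
    divDiff j i (coX i : MvPolynomial (Fin N) F) = ∏ k ∈ (univ.erase i).erase j, X k := by
  apply divDiff_eq h
  rw [rename_coX, Equiv.swap_apply_right, ← X_mul_prod_erase_erase h,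
    ← X_mul_prod_erase_erase h.symm, erase_right_comm]
  ring

theorem divDiff_coX_left {i j : Fin N} (h : j ≠ i) :
    divDiff i j (coX i : MvPolynomial (Fin N) F) = -∏ k ∈ (univ.erase j).erase i, X k := by
  apply divDiff_eq h.symm
  rw [rename_coX, Equiv.swap_apply_left, ← X_mul_prod_erase_erase h,
    ← X_mul_prod_erase_erase h.symm, erase_right_comm]
  ring

theorem dunklD_coX_mul_of_ne {i j : Fin N} (h : j ≠ i) (f : MvPolynomial (Fin N) F) :
    dunklD β j (coX i * f) = coX i * (dunklD β j f + f + β • rename (Equiv.swap i j) f) := by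
  rw [dunklD_apply, dunkl_mul, sum_eq_single i, pderiv_coX_of_ne h, divDiff_coX_right h,
    dunklD_apply, Equiv.swap_comm j i, mul_add, mul_add, ← mul_assoc (X j) (∏ _ ∈ _, _) f,
    mul_smul_comm, ← mul_assoc (X j) (∏ _ ∈ _, _), X_mul_prod_erase_erase h]
  · simp only [mul_add, mul_smul_comm]
    ring
  · intro k hk hki
    rw [divDiff_of_symm (ne_of_mem_erase hk).symm, zero_mul]
    rw [rename_coX, Equiv.swap_apply_of_ne_of_ne h.symm hki.symm]
  · simp [h.symm]

theorem dunklD_coX_mul_self (i : Fin N) (f : MvPolynomial (Fin N) F) :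
    dunklD β i (coX i * f) =
      coX i * dunklD β i f - β • ∑ k ∈ univ.erase i, coX k * rename (Equiv.swap i k) f := by
  have h : ∀ k ∈ univ.erase i, X i * (divDiff i k (coX i) * rename (Equiv.swap i k) f) =
      -(coX k * rename (Equiv.swap i k) f) := by
    intro k hk
    rw [divDiff_coX_left (ne_of_mem_erase hk),
      ← X_mul_prod_erase_erase (ne_of_mem_erase hk).symm]
    ring
  rw [dunklD_apply, dunkl_mul, dunklD_apply, coX, zJ,
    pderiv_prod_X_of_notMem (notMem_erase _ _), zero_mul, add_zero, mul_add, mul_smul_comm,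
    mul_sum, ← zJ, ← coX, sum_congr rfl h, sum_neg_distrib, smul_neg, sub_eq_add_neg,
    mul_left_comm]

theorem Bplus_eq_sum (hN : 0 < N) (f : MvPolynomial (Fin N) F) :
    Bplus β (N - 1) univ f = ∑ i, coX i * coDunkl β f i := by
  have h : powersetCard (N - 1) (univ : Finset (Fin N)) = univ.image fun i => univ.erase i := by
    ext J
    simp only [mem_powersetCard, subset_univ, true_and, mem_image, mem_univ]
    constructor
    · intro hJ
      have hc : (Jᶜ).card = 1 := by
        rw [card_compl, hJ, Fintype.card_fin]
        omega
      obtain ⟨i, hi⟩ := card_eq_one.1 hc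
      refine ⟨i, ?_⟩
      rw [← compl_singleton, ← hi, compl_compl]
    · rintro ⟨i, rfl⟩
      rw [card_erase_of_mem (mem_univ i), card_univ, Fintype.card_fin]
  rw [Bplus, h, sum_image fun i _ j _ hij => ?_]
  · exact sum_congr rfl fun i _ => by rw [DJ, Dlist_eq_dunklList, coX, coDunkl]
  · by_contra hne
    have : j ∈ univ.erase i := mem_erase.2 ⟨Ne.symm hne, mem_univ j⟩
    rw [hij] at this
    exact notMem_erase j univ this

variable {f : MvPolynomial (Fin N) F}

theorem rename_DJ_univ (hf : f.IsSymmetric) (σ : Equiv.Perm (Fin N)) :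
    rename σ (DJ β 0 univ f) = DJ β 0 univ f := by
  rcases N.eq_zero_or_pos with rfl | hN
  · rw [Subsingleton.elim σ 1]
    exact rename_id_apply _
  · rw [← dunklD_coDunkl β hf ⟨0, hN⟩, rename_dunklD, rename_coDunkl β hf,
      dunklD_coDunkl β hf, dunklD_coDunkl β hf]

theorem dunklD_sq_coX_mul_of_ne (hf : f.IsSymmetric) {i j : Fin N} (h : j ≠ i) :
    dunklD β j (dunklD β j (coX i * coDunkl β f i)) =
      coX i * (dunklD β j (dunklD β j (coDunkl β f i)) + (2 : F) • dunklD β j (coDunkl β f i) +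
        coDunkl β f i + (2 * β) • coDunkl β f j + β ^ 2 • coDunkl β f i +
        β • DJ β 0 univ f + β • dunklD β i (coDunkl β f j)) := by
  rw [dunklD_coX_mul_of_ne β h, dunklD_coX_mul_of_ne β h]
  congr 1
  simp only [map_add, map_smul, rename_dunklD, rename_coDunkl β hf, Equiv.swap_apply_left,
    Equiv.swap_apply_right, dunklD_coDunkl β hf]
  module

theorem dunklD_sq_coX_mul_self (hf : f.IsSymmetric) (i : Fin N) :
    dunklD β i (dunklD β i (coX i * coDunkl β f i)) =
      coX i * dunklD β i (DJ β 0 univ f) - β • ∑ k ∈ univ.erase i,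
        coX k * (DJ β 0 univ f + dunklD β i (coDunkl β f k) + coDunkl β f k +
          β • coDunkl β f i) := by
  have h : ∀ k ∈ univ.erase i, dunklD β i (coX k * coDunkl β f k) =
      coX k * (dunklD β i (coDunkl β f k) + coDunkl β f k + β • coDunkl β f i) := by
    intro k hk
    rw [dunklD_coX_mul_of_ne β (ne_of_mem_erase hk).symm, rename_coDunkl β hf,
      Equiv.swap_apply_left]
  rw [dunklD_coX_mul_self, dunklD_coDunkl β hf]
  simp only [rename_coDunkl β hf, Equiv.swap_apply_left]
  rw [map_sub, map_smul, map_sum, dunklD_coX_mul_self, sum_congr rfl h]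
  simp only [rename_DJ_univ β hf, add_assoc, mul_add, sum_add_distrib, smul_add]
  abel

theorem sum_dunklD_sq_sum_coX_mul (hf : f.IsSymmetric) :
    ∑ j, dunklD β j (dunklD β j (∑ i, coX i * coDunkl β f i)) =
      ∑ i, coX i * (dunklD β i (DJ β 0 univ f) + ∑ j ∈ univ.erase i,
        (dunklD β j (dunklD β j (coDunkl β f i)) + (2 - β) • dunklD β j (coDunkl β f i) +
          (1 - β + β ^ 2) • coDunkl β f i + (2 * β - β ^ 2) • coDunkl β f j +
          β • dunklD β i (coDunkl β f j))) := by
  have hswap : ∑ i, ∑ k ∈ univ.erase i,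
        coX k * (DJ β 0 univ f + dunklD β i (coDunkl β f k) + coDunkl β f k +
          β • coDunkl β f i) = ∑ i, coX i * ∑ j ∈ univ.erase i,
        (DJ β 0 univ f + dunklD β j (coDunkl β f i) + coDunkl β f i + β • coDunkl β f j) := by
    simp only [mul_sum]
    exact sum_comm' fun i k => by simp [eq_comm]
  simp only [map_sum]
  rw [sum_comm, sum_congr rfl fun i _ => (add_sum_erase univ _ (mem_univ i)).symm]
  have hoff : ∀ i, ∑ j ∈ univ.erase i, dunklD β j (dunklD β j (coX i * coDunkl β f i)) = _ :=
    fun i => sum_congr rfl fun j hj => dunklD_sq_coX_mul_of_ne β hf (ne_of_mem_erase hj)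
  simp only [hoff, dunklD_sq_coX_mul_self β hf]
  rw [sum_add_distrib, sum_sub_distrib, ← smul_sum, hswap, smul_sum, ← sum_sub_distrib,
    ← sum_add_distrib]
  refine sum_congr rfl fun i _ => ?_
  rw [← mul_sum, ← mul_smul_comm, ← mul_sub, ← mul_add, smul_sum, sub_add_eq_add_sub, add_sub_assoc,
    ← sum_sub_distrib]
  congr 2
  refine sum_congr rfl fun j _ => ?_
  module

theorem coDunkl_sum_dunklD_sq_add [CharZero F] (hf : f.IsSymmetric) (i : Fin N) :
    dunklD β i (DJ β 0 univ f) + ∑ j ∈ univ.erase i,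
        (dunklD β j (dunklD β j (coDunkl β f i)) + (2 - β) • dunklD β j (coDunkl β f i) +
          (1 - β + β ^ 2) • coDunkl β f i + (2 * β - β ^ 2) • coDunkl β f j +
          β • dunklD β i (coDunkl β f j)) =
      coDunkl β (∑ a, dunklD β a (dunklD β a f)) i +
        coDunkl β ((2 : F) • ∑ a, dunklD β a f + (((N - 1 : ℕ) : F) * (1 + β)) • f) i -
        (2 : F) • DJ β 0 univ f := by
  have hcard : (((N - 1 : ℕ) : F) * (1 + β)) • coDunkl β f i =
      ∑ j ∈ univ.erase i, (1 + β) • coDunkl β f i := by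
    rw [sum_const, card_erase_of_mem (mem_univ i), card_univ, Fintype.card_fin, mul_smul,
      Nat.cast_smul_eq_nsmul]
  rw [coDunkl.eq_1 β (∑ a, dunklD β a (dunklD β a f)), coDunkl.eq_1 β (_ + _), map_add, map_smul,
    map_smul, dunklList_sum_dunklD_sq β hf, dunklList_sum_dunklD β hf, ← coDunkl.eq_1, hcard]
  simp only [← add_sum_erase univ _ (mem_univ i), dunklD_coDunkl β hf, sub_self, zero_add]
  simp only [sum_add_distrib, sum_sub_distrib, ← smul_sum]
  module

end CoMonomial

/-- there is a linear operator `G` such that, for every symmetric `f`,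
`[∑ᵢ Dᵢ², B⁺_{N-1}] f = B⁺_{N-1} (2 ∑ᵢ Dᵢ + (N-1)(1+β)) f + G (Ñ_N f)`. -/
theorem statement_16 {F : Type*} [Field F] [CharZero F] {N : ℕ} (β : F) :
    ∃ G : MvPolynomial (Fin N) F →ₗ[F] MvPolynomial (Fin N) F,
      ∀ f : MvPolynomial (Fin N) F, f.IsSymmetric →
        (∑ i : Fin N, Dop β i (Dop β i (Bplus β (N - 1) Finset.univ f)))
            - Bplus β (N - 1) Finset.univ (∑ i : Fin N, Dop β i (Dop β i f))
        = Bplus β (N - 1) Finset.univ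
            ((2 : F) • (∑ i : Fin N, Dop β i f) + (((N - 1 : ℕ) : F) * (1 + β)) • f)
          + G (DJ β 0 Finset.univ f) := by
  refine ⟨LinearMap.mulLeft F ((-2 : F) • ∑ i, coX i), fun f hf => ?_⟩
  rcases N.eq_zero_or_pos with rfl | hN
  · simp [Bplus, DJ, Dlist_eq_dunklList]
  simp only [Dop_eq_dunklD, Bplus_eq_sum β hN]
  rw [sum_dunklD_sq_sum_coX_mul β hf,
    sum_congr rfl fun i _ => congrArg (coX i * ·) (coDunkl_sum_dunklD_sq_add β hf i)]
  simp only [mul_sub, mul_add, sum_sub_distrib, sum_add_distrib, LinearMap.mulLeft_apply,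
    smul_mul_assoc, sum_mul, mul_smul_comm, ← smul_sum]
  module
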